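/- Fix ν ∈ (0,1). For every integer j ≥ 3 and every k with 0 ≤ k ≤ j−2, the transformed coefficients satisfy d̄_k^j > 0. -/

import Mathlib

open Real Finset

noncomputable section

/-- α₀ = (ν+2)/(2^ν·Γ(3−ν)). -/
def alpha0 (ν : ℝ) : ℝ := (ν + 2) / ((2 : ℝ) ^ ν * Real.Gamma (3 - ν))

/-- θ = 2ν/(2+ν). -/
def theta (ν : ℝ) : ℝ := 2 * ν / (2 + ν)

/-- The coefficients D̄_k^(m). -/
def Dbar (ν : ℝ) (m k : ℕ) : ℝ :=
  if k = 0 then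
    (1 / Real.Gamma (3 - ν)) *
      (-((2 - ν) / 2) * ((2 * m : ℝ) ^ (1 - ν) + 3 * ((2 * m : ℝ) + 2) ^ (1 - ν))
        - (2 * m : ℝ) ^ (2 - ν) + ((2 * m : ℝ) + 2) ^ (2 - ν))
  else if k % 2 = 0 then
    (1 / Real.Gamma (3 - ν)) *
      (-((2 - ν) / 2) * (((2 * m : ℝ) - 2 * (k / 2 : ℕ)) ^ (1 - ν)
          + 6 * ((2 * m : ℝ) - 2 * (k / 2 : ℕ) + 2) ^ (1 - ν)
          + ((2 * m : ℝ) - 2 * (k / 2 : ℕ) + 4) ^ (1 - ν))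
        - ((2 * m : ℝ) - 2 * (k / 2 : ℕ)) ^ (2 - ν)
        + ((2 * m : ℝ) - 2 * (k / 2 : ℕ) + 4) ^ (2 - ν))
  else
    (2 / Real.Gamma (3 - ν)) *
      ((2 - ν) * (((2 * m : ℝ) - 2 * (k / 2 : ℕ)) ^ (1 - ν)
          + ((2 * m : ℝ) - 2 * (k / 2 : ℕ) + 2) ^ (1 - ν))
        + ((2 * m : ℝ) - 2 * (k / 2 : ℕ)) ^ (2 - ν)
        - ((2 * m : ℝ) - 2 * (k / 2 : ℕ) + 2) ^ (2 - ν))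

/-- The coefficients D_k^(m); for k ≥ 3 one has D_k^(m) = D̄_{k+1}^(m). -/
def Dco (ν : ℝ) (m k : ℕ) : ℝ :=
  if k = 0 then
    (1 / Real.Gamma (3 - ν)) *
      (((2 - ν) / 2) * ((2 * m : ℝ) ^ (1 - ν) - 3 * ((2 * m : ℝ) + 1) ^ (1 - ν))
        - (2 * m : ℝ) ^ (2 - ν) + ((2 * m : ℝ) + 1) ^ (2 - ν))
  else if k = 1 then
    (1 / Real.Gamma (3 - ν)) *
      (-((2 - ν) / 2) * (((2 * m : ℝ) - 2) ^ (1 - ν) + 3 * (2 * m : ℝ) ^ (1 - ν)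
          - 4 * ((2 * m : ℝ) + 1) ^ (1 - ν))
        - ((2 * m : ℝ) - 2) ^ (2 - ν) + 3 * (2 * m : ℝ) ^ (2 - ν)
        - 2 * ((2 * m : ℝ) + 1) ^ (2 - ν))
  else if k = 2 then
    (1 / Real.Gamma (3 - ν)) *
      (((2 - ν) / 2) * (4 * ((2 * m : ℝ) - 2) ^ (1 - ν) + 3 * (2 * m : ℝ) ^ (1 - ν)
          - ((2 * m : ℝ) + 1) ^ (1 - ν))
        + 2 * ((2 * m : ℝ) - 2) ^ (2 - ν) - 3 * (2 * m : ℝ) ^ (2 - ν)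
        + ((2 * m : ℝ) + 1) ^ (2 - ν))
  else Dbar ν m (k + 1)

/-- The scheme coefficients d_k^j. -/
def dco (ν : ℝ) (j k : ℕ) : ℝ :=
  if j % 2 = 1 then -Dco ν (j / 2) k / alpha0 ν
  else -Dbar ν (j / 2 - 1) k / alpha0 ν

/-- The transformed coefficients d̄_k^j. -/
def dbarco (ν : ℝ) (j k : ℕ) : ℝ :=
  if k = j then -1
  else if j = 3 then
    if k = 2 then dco ν 3 2 - theta ν
    else if k = 1 then theta ν * (dco ν 3 2 - theta ν) + dco ν 3 1
    else theta ν * (theta ν * (dco ν 3 2 - theta ν) + dco ν 3 1) + dco ν 3 0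
  else
    theta ν ^ (j - k) + ∑ k' ∈ Finset.Icc k (j - 2), dco ν j k' * theta ν ^ (k' - k)

/-- The coefficients B̄_i^n: B̄_0^n = Δx^{−ν}α₀ and
    B̄_{n−k}^n = B̄_{n−k−1}^n − Δx^{−ν}·α₀·d̄_k^n for k = n−1,…,1. -/
def Bbar (ν Δx : ℝ) (n : ℕ) : ℕ → ℝ
  | 0 => Δx ^ (-ν) * alpha0 ν
  | i + 1 => Bbar ν Δx n i - Δx ^ (-ν) * alpha0 ν * dbarco ν n (n - (i + 1))

/-- The complementary discrete kernels P_j^n. -/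
def Pker (ν Δx : ℝ) (n : ℕ) : ℕ → ℝ
  | 0 => 1 / Bbar ν Δx n 0
  | j + 1 =>
    if n ≤ j + 3 then 0
    else (1 / Bbar ν Δx (n - (j + 1)) 0) *
      ∑ k ∈ (Finset.range (j + 1)).attach,
        (Bbar ν Δx (n - k.1) (j - k.1) - Bbar ν Δx (n - k.1) (j + 1 - k.1)) * Pker ν Δx n k.1
  decreasing_by
    have := Finset.mem_range.mp k.2; omega

/-- D̂_0, D̂_1, D̂_2, D̃_0, D̃_1, D̃_2 : first/second-step coefficients. -/
def Dhat0 (ν : ℝ) : ℝ := (3 * ν - 4) / (2 * Real.Gamma (3 - ν))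
def Dhat1 (ν : ℝ) : ℝ := 2 * (1 - ν) / Real.Gamma (3 - ν)
def Dhat2 (ν : ℝ) : ℝ := ν / (2 * Real.Gamma (3 - ν))
def Dtil0 (ν : ℝ) : ℝ := (3 * ν - 2) / ((2 : ℝ) ^ ν * Real.Gamma (3 - ν))
def Dtil1 (ν : ℝ) : ℝ := -(4 * ν) / ((2 : ℝ) ^ ν * Real.Gamma (3 - ν))
def Dtil2 (ν : ℝ) : ℝ := (ν + 2) / ((2 : ℝ) ^ ν * Real.Gamma (3 - ν))

/-- The Caputo fractional derivative of order ν. -/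
def caputo (ν : ℝ) (y : ℝ → ℝ) (x : ℝ) : ℝ :=
  (1 / Real.Gamma (1 - ν)) * ∫ s in (0:ℝ)..x, (x - s) ^ (-ν) * deriv y s

/-- The discrete Caputo derivative of a function y at the grid point x_j = jΔx. -/
def discCaputo (ν Δx : ℝ) (y : ℝ → ℝ) (j : ℕ) : ℝ :=
  if j = 1 then
    Δx ^ (-ν) * (Dhat0 ν * y 0 + Dhat1 ν * y Δx + Dhat2 ν * y (2 * Δx))
  else if j = 2 then
    Δx ^ (-ν) * (Dtil0 ν * y 0 + Dtil1 ν * y Δx + Dtil2 ν * y (2 * Δx))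
  else if j % 2 = 1 then
    Δx ^ (-ν) * ((∑ k ∈ Finset.range j, Dco ν (j / 2) k * y ((k : ℝ) * Δx))
      + alpha0 ν * y ((j : ℝ) * Δx))
  else
    Δx ^ (-ν) * ((∑ k ∈ Finset.range j, Dbar ν (j / 2 - 1) k * y ((k : ℝ) * Δx))
      + alpha0 ν * y ((j : ℝ) * Δx))

/-- Truncation error r_j(Δx). -/
def trunc (ν Δx : ℝ) (y : ℝ → ℝ) (j : ℕ) : ℝ :=
  caputo ν y ((j : ℝ) * Δx) - discCaputo ν Δx y j

/-- The Mittag–Leffler function E_ν(z) = Σ_{k≥0} z^k/Γ(1+kν). -/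
def mlE (ν z : ℝ) : ℝ := ∑' k : ℕ, z ^ k / Real.Gamma (1 + (k : ℝ) * ν)

end

/-- Derivative of an affine function raised to a real power. -/
lemma hasDerivAt_affine_rpow {a u r s : ℝ} (hs : s = r - 1) (h : 0 < 1 + a * u) :
    HasDerivAt (fun t : ℝ => (1 + a * t) ^ r) (a * r * (1 + a * u) ^ s) u := by
  subst hs
  have h1 : HasDerivAt (fun t : ℝ => 1 + a * t) a u := by
    simpa using ((hasDerivAt_id u).const_mul a).const_add 1
  exact h1.rpow_const (Or.inl h.ne')

/-- A function vanishing at `0` with positive derivative on `(0, b)` is positive on `(0, b]`. -/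
lemma pos_of_hasDerivAt_pos {g g' : ℝ → ℝ} {b : ℝ}
    (hg : ∀ u ∈ Set.Icc 0 b, HasDerivAt g (g' u) u) (h0 : g 0 = 0)
    (hpos : ∀ u ∈ Set.Ioo 0 b, 0 < g' u) {u : ℝ} (hu : u ∈ Set.Ioc 0 b) : 0 < g u := by
  have hm : StrictMonoOn g (Set.Icc 0 b) := by
    refine strictMonoOn_of_deriv_pos (convex_Icc 0 b)
      (fun x hx => (hg x hx).continuousAt.continuousWithinAt) fun x hx => ?_
    rw [interior_Icc] at hx
    rw [(hg x (Set.Ioo_subset_Icc_self hx)).deriv]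
    exact hpos x hx
  have := hm ⟨le_rfl, hu.1.le.trans hu.2⟩ ⟨hu.1.le, hu.2⟩ hu.1
  rwa [h0] at this

/-- A function vanishing to first order at `0` with positive second derivative on `(0, b)` is
positive on `(0, b]`. -/
lemma pos_of_hasDerivAt_two_pos {g g' g'' : ℝ → ℝ} {b : ℝ}
    (hg : ∀ u ∈ Set.Icc 0 b, HasDerivAt g (g' u) u)
    (hg' : ∀ u ∈ Set.Icc 0 b, HasDerivAt g' (g'' u) u) (h0 : g 0 = 0) (h0' : g' 0 = 0)
    (hpos : ∀ u ∈ Set.Ioo 0 b, 0 < g'' u) {u : ℝ} (hu : u ∈ Set.Ioc 0 b) : 0 < g u :=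
  pos_of_hasDerivAt_pos hg h0 (fun _ hx => pos_of_hasDerivAt_pos
    (fun _ hy => hg' _ ⟨hy.1, hy.2.trans hx.2.le⟩) h0'
    (fun _ hy => hpos _ ⟨hy.1, hy.2.trans hx.2⟩) ⟨hx.1, le_rfl⟩) hu

/-- Bernoulli's inequality for the ratio of two powers. -/
lemma mul_rpow_neg_le {ν a b : ℝ} (hν : ν ∈ Set.Ioo (0 : ℝ) 1) (ha : 0 < a) (hb : 0 < b) :
    b * b ^ (-ν) ≤ (b + ν * (a - b)) * a ^ (-ν) := by
  have h := rpow_one_add_le_one_add_mul_self (s := a / b - 1) (p := ν)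
    (by have := (div_pos ha hb).le; linarith) hν.1.le hν.2.le
  rw [add_sub_cancel, Real.div_rpow ha.le hb.le, div_le_iff₀ (Real.rpow_pos_of_pos hb ν)] at h
  rw [Real.rpow_neg ha.le, Real.rpow_neg hb.le, ← div_eq_mul_inv, ← div_eq_mul_inv,
    div_le_div_iff₀ (Real.rpow_pos_of_pos hb ν) (Real.rpow_pos_of_pos ha ν)]
  calc b * a ^ ν ≤ b * ((1 + ν * (a / b - 1)) * b ^ ν) := by gcongr
    _ = _ := by field_simp

lemma rpow_neg_eq_mul_rpow {ν x : ℝ} (hx : 0 < x) :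
    x ^ (-ν) = x * x ^ (-ν - 1) := by
  rw [Real.rpow_sub_one hx.ne']; field_simp

lemma trapezoid_unit_pos {ν u : ℝ} (hν : ν ∈ Set.Ioo (0 : ℝ) 1)
    (hu : u ∈ Set.Ioc (0 : ℝ) (1 / 4)) :
    0 < 1 - (1 + -2 * u) ^ (2 - ν)
      - (2 - ν) * (u * ((1 + -2 * u) ^ (1 - ν) + 1)) := by
  refine pos_of_hasDerivAt_two_pos (b := 1 / 4)
    (g := fun u => 1 - (1 + -2 * u) ^ (2 - ν) - (2 - ν) * (u * ((1 + -2 * u) ^ (1 - ν) + 1)))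
    (g' := fun u => (2 - ν) * ((1 + -2 * u) ^ (1 - ν) - 1
      + 2 * (1 - ν) * (u * (1 + -2 * u) ^ (-ν))))
    (g'' := fun u => (2 - ν) * (1 - ν) * (4 * ν * u * (1 + -2 * u) ^ (-ν - 1)))
    (fun x hx => ?_) (fun x hx => ?_) (by simp) (by simp) (fun x hx => ?_) hu
  · have h : 0 < 1 + -2 * x := by linarith [hx.2]
    have d2 := hasDerivAt_affine_rpow (a := -2) (r := 2 - ν) (s := 1 - ν) (by ring) h
    have d1 := hasDerivAt_affine_rpow (a := -2) (r := 1 - ν) (s := -ν) (by ring) h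
    refine HasDerivAt.congr_deriv
      ((d2.const_sub 1).sub
        (((hasDerivAt_id x).mul (d1.add_const 1)).const_mul (2 - ν))) ?_
    simp only [id]
    ring
  · have h : 0 < 1 + -2 * x := by linarith [hx.2]
    have d1 := hasDerivAt_affine_rpow (a := -2) (r := 1 - ν) (s := -ν) (by ring) h
    have d0 := hasDerivAt_affine_rpow (a := -2) (r := -ν) (s := -ν - 1) (by ring) h
    refine HasDerivAt.congr_deriv (((d1.sub_const 1).add
      (((hasDerivAt_id x).mul d0).const_mul (2 * (1 - ν)))).const_mul (2 - ν)) ?_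
    simp only [id]
    ring
  · have h : 0 < 1 + -2 * x := by linarith [hx.2]
    have := Real.rpow_pos_of_pos h (-ν - 1)
    have := hν.1
    have : 0 < 1 - ν := by linarith [hν.2]
    have : 0 < 2 - ν := by linarith
    have := hx.1
    positivity

lemma mixed_unit_pos {ν u : ℝ} (hν : ν ∈ Set.Ioo (0 : ℝ) 1)
    (hu : u ∈ Set.Ioc (0 : ℝ) (1 / 2)) :
    0 < (2 - ν) * (u * ((1 + -1 * u) ^ (1 - ν) + 6 + (1 + 1 * u) ^ (1 - ν)))
      + 4 * ((1 + -1 * u) ^ (2 - ν) - (1 + 1 * u) ^ (2 - ν)) := by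
  refine pos_of_hasDerivAt_two_pos (b := 1 / 2)
    (g := fun u => (2 - ν) * (u * ((1 + -1 * u) ^ (1 - ν) + 6 + (1 + 1 * u) ^ (1 - ν)))
      + 4 * ((1 + -1 * u) ^ (2 - ν) - (1 + 1 * u) ^ (2 - ν)))
    (g' := fun u => (2 - ν) * (6 - 3 * ((1 + -1 * u) ^ (1 - ν) + (1 + 1 * u) ^ (1 - ν))
      + (1 - ν) * (u * ((1 + 1 * u) ^ (-ν) - (1 + -1 * u) ^ (-ν)))))
    (g'' := fun u => (2 - ν) * (1 - ν) * (2 * ((1 + -1 * u) ^ (-ν) - (1 + 1 * u) ^ (-ν))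
      - ν * u * ((1 + 1 * u) ^ (-ν - 1) + (1 + -1 * u) ^ (-ν - 1))))
    (fun x hx => ?_) (fun x hx => ?_) (by simp) (by norm_num) (fun x hx => ?_) hu
  · have h : 0 < 1 + -1 * x := by linarith [hx.2]
    have k : 0 < 1 + 1 * x := by linarith [hx.1]
    have d2 := hasDerivAt_affine_rpow (a := -1) (r := 2 - ν) (s := 1 - ν) (by ring) h
    have d1 := hasDerivAt_affine_rpow (a := -1) (r := 1 - ν) (s := -ν) (by ring) h
    have e2 := hasDerivAt_affine_rpow (a := 1) (r := 2 - ν) (s := 1 - ν) (by ring) k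
    have e1 := hasDerivAt_affine_rpow (a := 1) (r := 1 - ν) (s := -ν) (by ring) k
    refine HasDerivAt.congr_deriv
      ((((hasDerivAt_id x).mul ((d1.add_const 6).add e1)).const_mul (2 - ν)).add
      ((d2.sub e2).const_mul 4)) ?_
    simp only [id, Pi.add_apply]
    ring
  · have h : 0 < 1 + -1 * x := by linarith [hx.2]
    have k : 0 < 1 + 1 * x := by linarith [hx.1]
    have d1 := hasDerivAt_affine_rpow (a := -1) (r := 1 - ν) (s := -ν) (by ring) h
    have d0 := hasDerivAt_affine_rpow (a := -1) (r := -ν) (s := -ν - 1) (by ring) h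
    have e1 := hasDerivAt_affine_rpow (a := 1) (r := 1 - ν) (s := -ν) (by ring) k
    have e0 := hasDerivAt_affine_rpow (a := 1) (r := -ν) (s := -ν - 1) (by ring) k
    refine HasDerivAt.congr_deriv (((((d1.add e1).const_mul 3).const_sub 6).add
      (((hasDerivAt_id x).mul (e0.sub d0)).const_mul (1 - ν))).const_mul (2 - ν)) ?_
    simp only [id, Pi.sub_apply]
    ring
  · obtain ⟨hx0, hx1⟩ := hx
    obtain ⟨hν0, hν1⟩ := hν
    have h : 0 < 1 + -1 * x := by linarith
    have k : 0 < 1 + 1 * x := by linarith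
    have bern := mul_rpow_neg_le ⟨hν0, hν1⟩ h k
    rw [rpow_neg_eq_mul_rpow h, rpow_neg_eq_mul_rpow k] at bern
    have hA := Real.rpow_pos_of_pos h (-ν - 1)
    have hB := Real.rpow_pos_of_pos k (-ν - 1)
    refine mul_pos (mul_pos (by linarith) (by linarith)) ?_
    rw [rpow_neg_eq_mul_rpow h, rpow_neg_eq_mul_rpow k]
    set A := (1 + -1 * x) ^ (-ν - 1)
    set B := (1 + 1 * x) ^ (-ν - 1)
    have key : 0 < ν * x * ((1 + x) * (2 - 4 * x) + 2 * ν * x * (1 - x)) := by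
      have : 0 < (1 + x) * (2 - 4 * x) := mul_pos (by linarith) (by linarith)
      have : 0 < 2 * ν * x * (1 - x) := mul_pos (by positivity) (by linarith)
      positivity
    refine pos_of_mul_pos_right (a := (1 + x) ^ 2) ?_ (by positivity)
    nlinarith [mul_pos key hA, mul_le_mul_of_nonneg_left bern
      (by nlinarith [mul_pos hν0 hx0] : (0 : ℝ) ≤ 2 * (1 + x) + ν * x)]

lemma one_three_unit_pos {ν u : ℝ} (hν : ν ∈ Set.Ioo (0 : ℝ) 1)
    (hu : u ∈ Set.Ioc (0 : ℝ) (1 / 2)) :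
    0 < (2 - ν) * (u * ((1 + -1 * u) ^ (1 - ν) + 3)) + 4 * ((1 + -1 * u) ^ (2 - ν) - 1) := by
  refine pos_of_hasDerivAt_two_pos (b := 1 / 2)
    (g := fun u => (2 - ν) * (u * ((1 + -1 * u) ^ (1 - ν) + 3)) + 4 * ((1 + -1 * u) ^ (2 - ν) - 1))
    (g' := fun u => (2 - ν) * (3 - 3 * (1 + -1 * u) ^ (1 - ν)
      - (1 - ν) * (u * (1 + -1 * u) ^ (-ν))))
    (g'' := fun u => (2 - ν) * (1 - ν) * (2 * (1 + -1 * u) ^ (-ν)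
      - ν * u * (1 + -1 * u) ^ (-ν - 1)))
    (fun x hx => ?_) (fun x hx => ?_) (by simp) (by simp) (fun x hx => ?_) hu
  · have h : 0 < 1 + -1 * x := by linarith [hx.2]
    have d2 := hasDerivAt_affine_rpow (a := -1) (r := 2 - ν) (s := 1 - ν) (by ring) h
    have d1 := hasDerivAt_affine_rpow (a := -1) (r := 1 - ν) (s := -ν) (by ring) h
    refine HasDerivAt.congr_deriv
      ((((hasDerivAt_id x).mul (d1.add_const 3)).const_mul (2 - ν)).add
      ((d2.sub_const 1).const_mul 4)) ?_
    simp only [id]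
    ring
  · have h : 0 < 1 + -1 * x := by linarith [hx.2]
    have d1 := hasDerivAt_affine_rpow (a := -1) (r := 1 - ν) (s := -ν) (by ring) h
    have d0 := hasDerivAt_affine_rpow (a := -1) (r := -ν) (s := -ν - 1) (by ring) h
    refine HasDerivAt.congr_deriv ((((d1.const_mul 3).const_sub 3).sub
      (((hasDerivAt_id x).mul d0).const_mul (1 - ν))).const_mul (2 - ν)) ?_
    simp only [id]
    ring
  · obtain ⟨hx0, hx1⟩ := hx
    obtain ⟨hν0, hν1⟩ := hν
    have h : 0 < 1 + -1 * x := by linarith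
    have hA := Real.rpow_pos_of_pos h (-ν - 1)
    refine mul_pos (mul_pos (by linarith) (by linarith)) ?_
    rw [rpow_neg_eq_mul_rpow h]
    have : 0 < 2 * (1 + -1 * x) - ν * x := by nlinarith
    nlinarith [mul_pos this hA]

lemma three_sub_one_unit_pos {ν u : ℝ} (hν : ν ∈ Set.Ioo (0 : ℝ) 1)
    (hu : u ∈ Set.Ioc (0 : ℝ) (1 / 2)) :
    0 < (2 - ν) * (u * (3 - (1 + -1 * u) ^ (1 - ν))) + 2 * ((1 + -1 * u) ^ (2 - ν) - 1) := by
  refine pos_of_hasDerivAt_pos (b := 1 / 2)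
    (g := fun u => (2 - ν) * (u * (3 - (1 + -1 * u) ^ (1 - ν))) + 2 * ((1 + -1 * u) ^ (2 - ν) - 1))
    (g' := fun u => (2 - ν) * (3 * (1 - (1 + -1 * u) ^ (1 - ν))
      + (1 - ν) * (u * (1 + -1 * u) ^ (-ν))))
    (fun x hx => ?_) (by simp) (fun x hx => ?_) hu
  · have h : 0 < 1 + -1 * x := by linarith [hx.2]
    have d2 := hasDerivAt_affine_rpow (a := -1) (r := 2 - ν) (s := 1 - ν) (by ring) h
    have d1 := hasDerivAt_affine_rpow (a := -1) (r := 1 - ν) (s := -ν) (by ring) h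
    refine HasDerivAt.congr_deriv
      ((((hasDerivAt_id x).mul (d1.const_sub 3)).const_mul (2 - ν)).add
      ((d2.sub_const 1).const_mul 2)) ?_
    simp only [id]
    ring
  · obtain ⟨hx0, hx1⟩ := hx
    obtain ⟨hν0, hν1⟩ := hν
    have h : 0 < 1 + -1 * x := by linarith
    have hA := Real.rpow_pos_of_pos h (-ν)
    have hB : (1 + -1 * x) ^ (1 - ν) < 1 := Real.rpow_lt_one h.le (by linarith) (by linarith)
    refine mul_pos (by linarith) (add_pos (by linarith) (mul_pos (by linarith) (by positivity)))

lemma second_unit_pos {ν u : ℝ} (hν : ν ∈ Set.Ioo (0 : ℝ) 1)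
    (hu : u ∈ Set.Ioc (0 : ℝ) (1 / 4)) :
    0 < -((2 - ν) * (u * (4 * (1 + -2 * u) ^ (1 - ν) + 3 - (1 + 1 * u) ^ (1 - ν))))
      - 2 * (2 * (1 + -2 * u) ^ (2 - ν) - 3 + (1 + 1 * u) ^ (2 - ν)) := by
  refine pos_of_hasDerivAt_two_pos (b := 1 / 4)
    (g := fun u => -((2 - ν) * (u * (4 * (1 + -2 * u) ^ (1 - ν) + 3 - (1 + 1 * u) ^ (1 - ν))))
      - 2 * (2 * (1 + -2 * u) ^ (2 - ν) - 3 + (1 + 1 * u) ^ (2 - ν)))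
    (g' := fun u => (2 - ν) * (4 * (1 + -2 * u) ^ (1 - ν) - 3 - (1 + 1 * u) ^ (1 - ν)
      + (1 - ν) * (u * (8 * (1 + -2 * u) ^ (-ν) + (1 + 1 * u) ^ (-ν)))))
    (g'' := fun u => (2 - ν) * (1 - ν) * (ν * u *
      (16 * (1 + -2 * u) ^ (-ν - 1) - (1 + 1 * u) ^ (-ν - 1))))
    (fun x hx => ?_) (fun x hx => ?_) (by norm_num) (by norm_num) (fun x hx => ?_) hu
  · have h : 0 < 1 + -2 * x := by linarith [hx.2]
    have k : 0 < 1 + 1 * x := by linarith [hx.1]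
    have d2 := hasDerivAt_affine_rpow (a := -2) (r := 2 - ν) (s := 1 - ν) (by ring) h
    have d1 := hasDerivAt_affine_rpow (a := -2) (r := 1 - ν) (s := -ν) (by ring) h
    have e2 := hasDerivAt_affine_rpow (a := 1) (r := 2 - ν) (s := 1 - ν) (by ring) k
    have e1 := hasDerivAt_affine_rpow (a := 1) (r := 1 - ν) (s := -ν) (by ring) k
    refine HasDerivAt.congr_deriv
      ((((hasDerivAt_id x).mul (((d1.const_mul 4).add_const 3).sub e1)).const_mul
      (2 - ν)).neg.sub ((((d2.const_mul 2).sub_const 3).add e2).const_mul 2)) ?_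
    simp only [id, Pi.sub_apply]
    ring
  · have h : 0 < 1 + -2 * x := by linarith [hx.2]
    have k : 0 < 1 + 1 * x := by linarith [hx.1]
    have d1 := hasDerivAt_affine_rpow (a := -2) (r := 1 - ν) (s := -ν) (by ring) h
    have d0 := hasDerivAt_affine_rpow (a := -2) (r := -ν) (s := -ν - 1) (by ring) h
    have e1 := hasDerivAt_affine_rpow (a := 1) (r := 1 - ν) (s := -ν) (by ring) k
    have e0 := hasDerivAt_affine_rpow (a := 1) (r := -ν) (s := -ν - 1) (by ring) k
    refine HasDerivAt.congr_deriv (((((d1.const_mul 4).sub_const 3).sub e1).add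
      (((hasDerivAt_id x).mul ((d0.const_mul 8).add e0)).const_mul (1 - ν))).const_mul
      (2 - ν)) ?_
    simp only [id, Pi.add_apply]
    ring
  · obtain ⟨hx0, hx1⟩ := hx
    obtain ⟨hν0, hν1⟩ := hν
    have h : 0 < 1 + -2 * x := by linarith
    have hA : 1 ≤ (1 + -2 * x) ^ (-ν - 1) :=
      Real.one_le_rpow_of_pos_of_le_one_of_nonpos h (by linarith) (by linarith)
    have hB : (1 + 1 * x) ^ (-ν - 1) ≤ 1 :=
      Real.rpow_le_one_of_one_le_of_nonpos (by linarith) (by linarith)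
    exact mul_pos (mul_pos (by linarith) (by linarith))
      (mul_pos (by positivity) (by linarith))

lemma first_unit_pos {ν u : ℝ} (hν : ν ∈ Set.Ioo (0 : ℝ) 1)
    (hu : u ∈ Set.Ioc (0 : ℝ) (1 / 4)) :
    0 < (2 - ν) * (u * ((1 + -2 * u) ^ (1 - ν) + 3 - 4 * (1 + 1 * u) ^ (1 - ν)))
      + 2 * ((1 + -2 * u) ^ (2 - ν) - 3 + 2 * (1 + 1 * u) ^ (2 - ν)) := by
  refine pos_of_hasDerivAt_two_pos (b := 1 / 4)
    (g := fun u => (2 - ν) * (u * ((1 + -2 * u) ^ (1 - ν) + 3 - 4 * (1 + 1 * u) ^ (1 - ν)))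
      + 2 * ((1 + -2 * u) ^ (2 - ν) - 3 + 2 * (1 + 1 * u) ^ (2 - ν)))
    (g' := fun u => (2 - ν) * (3 - 3 * (1 + -2 * u) ^ (1 - ν)
      - 2 * (1 - ν) * (u * ((1 + -2 * u) ^ (-ν) + 2 * (1 + 1 * u) ^ (-ν)))))
    (g'' := fun u => 4 * ((2 - ν) * (1 - ν)) * ((1 + -2 * u) ^ (-ν) - (1 + 1 * u) ^ (-ν)
      - ν * u * ((1 + -2 * u) ^ (-ν - 1) - (1 + 1 * u) ^ (-ν - 1))))
    (fun x hx => ?_) (fun x hx => ?_) (by norm_num) (by norm_num) (fun x hx => ?_) hu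
  · have h : 0 < 1 + -2 * x := by linarith [hx.2]
    have k : 0 < 1 + 1 * x := by linarith [hx.1]
    have d2 := hasDerivAt_affine_rpow (a := -2) (r := 2 - ν) (s := 1 - ν) (by ring) h
    have d1 := hasDerivAt_affine_rpow (a := -2) (r := 1 - ν) (s := -ν) (by ring) h
    have e2 := hasDerivAt_affine_rpow (a := 1) (r := 2 - ν) (s := 1 - ν) (by ring) k
    have e1 := hasDerivAt_affine_rpow (a := 1) (r := 1 - ν) (s := -ν) (by ring) k
    refine HasDerivAt.congr_deriv
      ((((hasDerivAt_id x).mul ((d1.add_const 3).sub (e1.const_mul 4))).const_mul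
      (2 - ν)).add (((d2.sub_const 3).add (e2.const_mul 2)).const_mul 2)) ?_
    simp only [id, Pi.sub_apply]
    ring
  · have h : 0 < 1 + -2 * x := by linarith [hx.2]
    have k : 0 < 1 + 1 * x := by linarith [hx.1]
    have d1 := hasDerivAt_affine_rpow (a := -2) (r := 1 - ν) (s := -ν) (by ring) h
    have d0 := hasDerivAt_affine_rpow (a := -2) (r := -ν) (s := -ν - 1) (by ring) h
    have e0 := hasDerivAt_affine_rpow (a := 1) (r := -ν) (s := -ν - 1) (by ring) k
    refine HasDerivAt.congr_deriv ((((d1.const_mul 3).const_sub 3).sub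
      (((hasDerivAt_id x).mul (d0.add (e0.const_mul 2))).const_mul (2 * (1 - ν)))).const_mul
      (2 - ν)) ?_
    simp only [id, Pi.add_apply]
    ring
  · obtain ⟨hx0, hx1⟩ := hx
    obtain ⟨hν0, hν1⟩ := hν
    have h : 0 < 1 + -2 * x := by linarith
    have k : 0 < 1 + 1 * x := by linarith
    have bern := mul_rpow_neg_le ⟨hν0, hν1⟩ h k
    rw [rpow_neg_eq_mul_rpow h, rpow_neg_eq_mul_rpow k] at bern
    have hA := Real.rpow_pos_of_pos h (-ν - 1)
    refine mul_pos (mul_pos four_pos (mul_pos (by linarith) (by linarith))) ?_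
    rw [rpow_neg_eq_mul_rpow h, rpow_neg_eq_mul_rpow k]
    set A := (1 + -2 * x) ^ (-ν - 1)
    set B := (1 + 1 * x) ^ (-ν - 1)
    have key : 0 < ν * x * ((1 + x) * (3 - 9 * x) - 3 * ν * x * (1 - 2 * x)) := by
      have : ν * (x * (1 - 2 * x)) ≤ x * (1 - 2 * x) :=
        mul_le_of_le_one_left (mul_pos hx0 (by linarith)).le hν1.le
      have : 0 < (1 + x) * (3 - 9 * x) - 3 * ν * x * (1 - 2 * x) := by nlinarith
      positivity
    refine pos_of_mul_pos_right (a := (1 + x) ^ 2) ?_ (by positivity)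
    nlinarith [mul_pos key hA, mul_le_mul_of_nonneg_left bern
      (by nlinarith : (0 : ℝ) ≤ 1 + x - ν * x)]

/-- Factoring out the scale `c` from a real power. -/
lemma rpow_eq_scale_mul {c u a y r : ℝ} (hc : 0 < c) (h : 0 ≤ 1 + a * u)
    (hy : y = c * (1 + a * u)) : y ^ r = c ^ r * (1 + a * u) ^ r := by
  rw [hy, Real.mul_rpow hc.le h]

lemma rpow_two_sub {ν c : ℝ} (hν : ν < 1) (hc : 0 ≤ c) : c ^ (2 - ν) = c * c ^ (1 - ν) := by
  rw [← Real.rpow_one_add' hc (by linarith)]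
  ring_nf

lemma trapezoid_neg {ν y : ℝ} (hν : ν ∈ Set.Ioo (0 : ℝ) 1) (hy : 2 ≤ y) :
    (2 - ν) * (y ^ (1 - ν) + (y + 2) ^ (1 - ν)) + y ^ (2 - ν) - (y + 2) ^ (2 - ν) < 0 := by
  have hc : 0 < y + 2 := by linarith
  have hu : 1 / (y + 2) ∈ Set.Ioc (0 : ℝ) (1 / 4) :=
    ⟨by positivity, one_div_le_one_div_of_le (by norm_num) (by linarith)⟩
  have key := mul_pos (Real.rpow_pos_of_pos hc (2 - ν)) (trapezoid_unit_pos hν hu)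
  have e : y = (y + 2) * (1 + -2 * (1 / (y + 2))) := by field_simp; ring
  have h : (0 : ℝ) ≤ 1 + -2 * (1 / (y + 2)) := by linarith [hu.2]
  rw [rpow_eq_scale_mul (r := 1 - ν) hc h e, rpow_eq_scale_mul (r := 2 - ν) hc h e]
  generalize (1 + -2 * (1 / (y + 2))) ^ (1 - ν) = A at key ⊢
  generalize (1 + -2 * (1 / (y + 2))) ^ (2 - ν) = B at key ⊢
  rw [rpow_two_sub hν.2 hc.le] at key ⊢
  generalize (y + 2) ^ (1 - ν) = C at key ⊢
  field_simp at key
  linarith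

lemma mixed_neg {ν y : ℝ} (hν : ν ∈ Set.Ioo (0 : ℝ) 1) (hy : 2 ≤ y) :
    -((2 - ν) / 2) * (y ^ (1 - ν) + 6 * (y + 2) ^ (1 - ν) + (y + 4) ^ (1 - ν))
      - y ^ (2 - ν) + (y + 4) ^ (2 - ν) < 0 := by
  have hc : 0 < y + 2 := by linarith
  have hu : 2 / (y + 2) ∈ Set.Ioc (0 : ℝ) (1 / 2) :=
    ⟨by positivity, by rw [div_le_div_iff₀ hc two_pos]; linarith⟩
  have key := mul_pos (Real.rpow_pos_of_pos hc (2 - ν)) (mixed_unit_pos hν hu)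
  have e : y = (y + 2) * (1 + -1 * (2 / (y + 2))) := by field_simp; ring
  have e' : y + 4 = (y + 2) * (1 + 1 * (2 / (y + 2))) := by field_simp; ring
  have h : (0 : ℝ) ≤ 1 + -1 * (2 / (y + 2)) := by linarith [hu.2]
  have h' : (0 : ℝ) ≤ 1 + 1 * (2 / (y + 2)) := by linarith [hu.1]
  rw [rpow_eq_scale_mul (r := 1 - ν) hc h e, rpow_eq_scale_mul (r := 2 - ν) hc h e,
    rpow_eq_scale_mul (r := 1 - ν) hc h' e', rpow_eq_scale_mul (r := 2 - ν) hc h' e']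
  generalize (1 + -1 * (2 / (y + 2))) ^ (1 - ν) = A at key ⊢
  generalize (1 + -1 * (2 / (y + 2))) ^ (2 - ν) = B at key ⊢
  generalize (1 + 1 * (2 / (y + 2))) ^ (1 - ν) = A' at key ⊢
  generalize (1 + 1 * (2 / (y + 2))) ^ (2 - ν) = B' at key ⊢
  rw [rpow_two_sub hν.2 hc.le] at key ⊢
  generalize (y + 2) ^ (1 - ν) = C at key ⊢
  field_simp at key
  linarith

lemma one_three_neg {ν y : ℝ} (hν : ν ∈ Set.Ioo (0 : ℝ) 1) (hy : 2 ≤ y) :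
    -((2 - ν) / 2) * (y ^ (1 - ν) + 3 * (y + 2) ^ (1 - ν))
      - y ^ (2 - ν) + (y + 2) ^ (2 - ν) < 0 := by
  have hc : 0 < y + 2 := by linarith
  have hu : 2 / (y + 2) ∈ Set.Ioc (0 : ℝ) (1 / 2) :=
    ⟨by positivity, by rw [div_le_div_iff₀ hc two_pos]; linarith⟩
  have key := mul_pos (Real.rpow_pos_of_pos hc (2 - ν)) (one_three_unit_pos hν hu)
  have e : y = (y + 2) * (1 + -1 * (2 / (y + 2))) := by field_simp; ring
  have h : (0 : ℝ) ≤ 1 + -1 * (2 / (y + 2)) := by linarith [hu.2]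
  rw [rpow_eq_scale_mul (r := 1 - ν) hc h e, rpow_eq_scale_mul (r := 2 - ν) hc h e]
  generalize (1 + -1 * (2 / (y + 2))) ^ (1 - ν) = A at key ⊢
  generalize (1 + -1 * (2 / (y + 2))) ^ (2 - ν) = B at key ⊢
  rw [rpow_two_sub hν.2 hc.le] at key ⊢
  generalize (y + 2) ^ (1 - ν) = C at key ⊢
  field_simp at key
  linarith

lemma one_sub_three_neg {ν y : ℝ} (hν : ν ∈ Set.Ioo (0 : ℝ) 1) (hy : 2 ≤ y) :
    ((2 - ν) / 2) * (y ^ (1 - ν) - 3 * (y + 1) ^ (1 - ν))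
      - y ^ (2 - ν) + (y + 1) ^ (2 - ν) < 0 := by
  have hc : 0 < y + 1 := by linarith
  have hu : 1 / (y + 1) ∈ Set.Ioc (0 : ℝ) (1 / 2) :=
    ⟨by positivity, one_div_le_one_div_of_le (by norm_num) (by linarith)⟩
  have key := mul_pos (Real.rpow_pos_of_pos hc (2 - ν)) (three_sub_one_unit_pos hν hu)
  have e : y = (y + 1) * (1 + -1 * (1 / (y + 1))) := by field_simp; ring
  have h : (0 : ℝ) ≤ 1 + -1 * (1 / (y + 1)) := by linarith [hu.2]
  rw [rpow_eq_scale_mul (r := 1 - ν) hc h e, rpow_eq_scale_mul (r := 2 - ν) hc h e]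
  generalize (1 + -1 * (1 / (y + 1))) ^ (1 - ν) = A at key ⊢
  generalize (1 + -1 * (1 / (y + 1))) ^ (2 - ν) = B at key ⊢
  rw [rpow_two_sub hν.2 hc.le] at key ⊢
  generalize (y + 1) ^ (1 - ν) = C at key ⊢
  field_simp at key
  linarith

lemma first_neg {ν c : ℝ} (hν : ν ∈ Set.Ioo (0 : ℝ) 1) (hc4 : 4 ≤ c) :
    -((2 - ν) / 2) * ((c - 2) ^ (1 - ν) + 3 * c ^ (1 - ν) - 4 * (c + 1) ^ (1 - ν))
      - (c - 2) ^ (2 - ν) + 3 * c ^ (2 - ν) - 2 * (c + 1) ^ (2 - ν) < 0 := by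
  have hc : 0 < c := by linarith
  have hu : 1 / c ∈ Set.Ioc (0 : ℝ) (1 / 4) :=
    ⟨by positivity, one_div_le_one_div_of_le (by norm_num) (by linarith)⟩
  have key := mul_pos (Real.rpow_pos_of_pos hc (2 - ν)) (first_unit_pos hν hu)
  have e : c - 2 = c * (1 + -2 * (1 / c)) := by field_simp; ring
  have e' : c + 1 = c * (1 + 1 * (1 / c)) := by field_simp
  have h : (0 : ℝ) ≤ 1 + -2 * (1 / c) := by linarith [hu.2]
  have h' : (0 : ℝ) ≤ 1 + 1 * (1 / c) := by linarith [hu.1]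
  rw [rpow_eq_scale_mul (r := 1 - ν) hc h e, rpow_eq_scale_mul (r := 2 - ν) hc h e,
    rpow_eq_scale_mul (r := 1 - ν) hc h' e', rpow_eq_scale_mul (r := 2 - ν) hc h' e']
  generalize (1 + -2 * (1 / c)) ^ (1 - ν) = A at key ⊢
  generalize (1 + -2 * (1 / c)) ^ (2 - ν) = B at key ⊢
  generalize (1 + 1 * (1 / c)) ^ (1 - ν) = A' at key ⊢
  generalize (1 + 1 * (1 / c)) ^ (2 - ν) = B' at key ⊢
  rw [rpow_two_sub hν.2 hc.le] at key ⊢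
  generalize c ^ (1 - ν) = C at key ⊢
  field_simp at key
  linarith

lemma second_neg {ν c : ℝ} (hν : ν ∈ Set.Ioo (0 : ℝ) 1) (hc4 : 4 ≤ c) :
    ((2 - ν) / 2) * (4 * (c - 2) ^ (1 - ν) + 3 * c ^ (1 - ν) - (c + 1) ^ (1 - ν))
      + 2 * (c - 2) ^ (2 - ν) - 3 * c ^ (2 - ν) + (c + 1) ^ (2 - ν) < 0 := by
  have hc : 0 < c := by linarith
  have hu : 1 / c ∈ Set.Ioc (0 : ℝ) (1 / 4) :=
    ⟨by positivity, one_div_le_one_div_of_le (by norm_num) (by linarith)⟩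
  have key := mul_pos (Real.rpow_pos_of_pos hc (2 - ν)) (second_unit_pos hν hu)
  have e : c - 2 = c * (1 + -2 * (1 / c)) := by field_simp; ring
  have e' : c + 1 = c * (1 + 1 * (1 / c)) := by field_simp
  have h : (0 : ℝ) ≤ 1 + -2 * (1 / c) := by linarith [hu.2]
  have h' : (0 : ℝ) ≤ 1 + 1 * (1 / c) := by linarith [hu.1]
  rw [rpow_eq_scale_mul (r := 1 - ν) hc h e, rpow_eq_scale_mul (r := 2 - ν) hc h e,
    rpow_eq_scale_mul (r := 1 - ν) hc h' e', rpow_eq_scale_mul (r := 2 - ν) hc h' e']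
  generalize (1 + -2 * (1 / c)) ^ (1 - ν) = A at key ⊢
  generalize (1 + -2 * (1 / c)) ^ (2 - ν) = B at key ⊢
  generalize (1 + 1 * (1 / c)) ^ (1 - ν) = A' at key ⊢
  generalize (1 + 1 * (1 / c)) ^ (2 - ν) = B' at key ⊢
  rw [rpow_two_sub hν.2 hc.le] at key ⊢
  generalize c ^ (1 - ν) = C at key ⊢
  field_simp at key
  linarith

lemma Gamma_three_sub_pos {ν : ℝ} (hν : ν ∈ Set.Ioo (0 : ℝ) 1) : 0 < Real.Gamma (3 - ν) :=
  Real.Gamma_pos_of_pos (by linarith [hν.2])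

lemma alpha0_pos {ν : ℝ} (hν : ν ∈ Set.Ioo (0 : ℝ) 1) : 0 < alpha0 ν := by
  have := Gamma_three_sub_pos hν
  have := hν.1
  unfold alpha0
  positivity

lemma theta_pos {ν : ℝ} (hν : ν ∈ Set.Ioo (0 : ℝ) 1) : 0 < theta ν := by
  have := hν.1
  unfold theta
  positivity

lemma Dbar_neg {ν : ℝ} (hν : ν ∈ Set.Ioo (0 : ℝ) 1) {m k : ℕ} (hk : k < 2 * m) :
    Dbar ν m k < 0 := by
  have hG := Gamma_three_sub_pos hν
  have hy : (2 : ℝ) ≤ 2 * m - 2 * (k / 2 : ℕ) := by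
    have : ((k / 2 + 1 : ℕ) : ℝ) ≤ m := by exact_mod_cast (by omega : k / 2 + 1 ≤ m)
    push_cast at this ⊢
    linarith
  unfold Dbar
  split_ifs with h0 h1
  · subst h0
    exact mul_neg_of_pos_of_neg (by positivity) (one_three_neg hν (by simpa using hy))
  · exact mul_neg_of_pos_of_neg (by positivity) (mixed_neg hν hy)
  · exact mul_neg_of_pos_of_neg (by positivity) (trapezoid_neg hν hy)

lemma Dco_zero_neg {ν : ℝ} (hν : ν ∈ Set.Ioo (0 : ℝ) 1) {m : ℕ} (hm : 1 ≤ m) :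
    Dco ν m 0 < 0 := by
  have hG := Gamma_three_sub_pos hν
  have hm' : (1 : ℝ) ≤ m := by exact_mod_cast hm
  rw [Dco, if_pos rfl]
  exact mul_neg_of_pos_of_neg (by positivity) (one_sub_three_neg hν (by linarith))

lemma Dco_neg {ν : ℝ} (hν : ν ∈ Set.Ioo (0 : ℝ) 1) {m k : ℕ} (hm : 2 ≤ m) (hk : k + 1 < 2 * m) :
    Dco ν m k < 0 := by
  have hG := Gamma_three_sub_pos hν
  have hm' : (2 : ℝ) ≤ m := by exact_mod_cast hm
  rcases k.eq_zero_or_pos with rfl | h0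
  · exact Dco_zero_neg hν (by omega)
  unfold Dco
  rw [if_neg h0.ne']
  split_ifs with h1 h2
  · exact mul_neg_of_pos_of_neg (by positivity) (first_neg hν (by linarith))
  · exact mul_neg_of_pos_of_neg (by positivity) (second_neg hν (by linarith))
  · exact Dbar_neg hν hk

lemma lt_twelve_sub_sq_mul_two_rpow {ν : ℝ} (hν : ν ∈ Set.Ioo (0 : ℝ) 1) :
    (12 + 8 * ν + ν ^ 2) < (12 - ν ^ 2) * 2 ^ ν := by
  obtain ⟨h0, h1⟩ := hν
  have hL : (0.693 : ℝ) * ν ≤ Real.log 2 * ν := by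
    have := Real.log_two_gt_d9
    gcongr
    linarith
  have hexp : 1 + 0.693 * ν + (0.693 * ν) ^ 2 / 2 ≤ (2 : ℝ) ^ ν := by
    rw [Real.rpow_def_of_pos two_pos]
    exact (Real.quadratic_le_exp_of_nonneg (by positivity)).trans (Real.exp_le_exp.2 hL)
  have hν2 : ν ^ 2 < 1 := by nlinarith
  nlinarith [mul_le_mul_of_nonneg_left hexp (by linarith : 0 ≤ 12 - ν ^ 2),
    mul_pos h0 (sub_pos.2 h1), mul_pos h0 (sub_pos.2 hν2), pow_pos h0 3,
    mul_pos (mul_pos h0 h0) (sub_pos.2 h1), mul_pos (mul_pos h0 h0) (sub_pos.2 hν2)]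

lemma theta_sq_sub_Dbar_pos {ν : ℝ} (hν : ν ∈ Set.Ioo (0 : ℝ) 1) {m : ℕ} (hm : 1 ≤ m) :
    0 < theta ν ^ 2 + -Dbar ν m (2 * m) / alpha0 ν := by
  have hG := Gamma_three_sub_pos hν
  have key := lt_twelve_sub_sq_mul_two_rpow hν
  obtain ⟨h0, h1⟩ := hν
  have h2 : (0 : ℝ) < 2 ^ ν := by positivity
  have e1 : (2 : ℝ) ^ (1 - ν) = 2 / 2 ^ ν := by rw [Real.rpow_sub two_pos, Real.rpow_one]
  have e2 : (4 : ℝ) ^ (1 - ν) = 4 / (2 ^ ν) ^ 2 := by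
    rw [Real.rpow_sub four_pos, Real.rpow_one, show (4 : ℝ) = 2 * 2 by norm_num,
      Real.mul_rpow two_pos.le two_pos.le, sq]
  have e3 : (4 : ℝ) ^ (2 - ν) = 16 / (2 ^ ν) ^ 2 := by
    rw [rpow_two_sub h1 four_pos.le, e2]; ring
  have hD : theta ν ^ 2 + -Dbar ν m (2 * m) / alpha0 ν
      = 2 * ((12 - ν ^ 2) * 2 ^ ν - (12 + 8 * ν + ν ^ 2)) / ((2 + ν) ^ 2 * 2 ^ ν) := by
    rw [Dbar, if_neg (by omega), if_pos (by omega), Nat.mul_div_cancel_left m two_pos, sub_self,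
      Real.zero_rpow (by linarith), Real.zero_rpow (by linarith), zero_add, zero_add, zero_add, e1, e2,
      e3, theta, alpha0]
    have : 2 + ν ≠ 0 := by positivity
    have : ν + 2 ≠ 0 := by positivity
    field_simp
    ring
  rw [hD]
  have := sub_pos.2 key
  positivity

lemma dco_pos {ν : ℝ} (hν : ν ∈ Set.Ioo (0 : ℝ) 1) {j k : ℕ} (hj : 4 ≤ j) (hk : k + 3 ≤ j) :
    0 < dco ν j k := by
  have hα := alpha0_pos hν
  unfold dco
  split_ifs with h
  · exact div_pos (neg_pos.2 (Dco_neg hν (by omega) (by omega))) hα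
  · exact div_pos (neg_pos.2 (Dbar_neg hν (by omega))) hα

lemma theta_sq_add_dco_pos {ν : ℝ} (hν : ν ∈ Set.Ioo (0 : ℝ) 1) {j : ℕ} (hj : 4 ≤ j) :
    0 < theta ν ^ 2 + dco ν j (j - 2) := by
  unfold dco
  split_ifs with h
  · have := theta_sq_sub_Dbar_pos hν (m := j / 2) (by omega)
    rwa [Dco, if_neg (by omega), if_neg (by omega), if_neg (by omega),
      show j - 2 + 1 = 2 * (j / 2) by omega]
  · have := theta_sq_sub_Dbar_pos hν (m := j / 2 - 1) (by omega)
    rwa [show j - 2 = 2 * (j / 2 - 1) by omega]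

lemma dbarco_three_one_pos {ν : ℝ} (hν : ν ∈ Set.Ioo (0 : ℝ) 1) :
    0 < theta ν * (dco ν 3 2 - theta ν) + dco ν 3 1 := by
  have hG := Gamma_three_sub_pos hν
  obtain ⟨h0, h1⟩ := hν
  have h2 : (0 : ℝ) < 2 ^ ν := by positivity
  have h3 : (0 : ℝ) < 3 ^ ν := by positivity
  have e1 : (2 : ℝ) ^ (1 - ν) = 2 / 2 ^ ν := by rw [Real.rpow_sub two_pos, Real.rpow_one]
  have e2 : (3 : ℝ) ^ (1 - ν) = 3 / 3 ^ ν := by rw [Real.rpow_sub three_pos, Real.rpow_one]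
  have bern : (3 : ℝ) ^ ν ≤ (1 + ν / 2) * 2 ^ ν := by
    have := rpow_one_add_le_one_add_mul_self (s := 1 / 2) (p := ν) (by norm_num) h0.le h1.le
    rw [show (1 : ℝ) + 1 / 2 = 3 / 2 by norm_num, Real.div_rpow three_pos.le two_pos.le,
      div_le_iff₀ h2] at this
    linarith
  have hE : theta ν * (dco ν 3 2 - theta ν) + dco ν 3 1
      = ((12 + 6 * ν + 3 * ν ^ 2) * 2 ^ ν - (12 + ν ^ 2) * 3 ^ ν) / ((2 + ν) ^ 2 * 3 ^ ν) := by
    norm_num [dco, Dco, theta, alpha0]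
    rw [Real.zero_rpow (by linarith), Real.zero_rpow (by linarith), rpow_two_sub h1 two_pos.le,
      rpow_two_sub h1 three_pos.le, e1, e2]
    have : 2 + ν ≠ 0 := by positivity
    have : ν + 2 ≠ 0 := by positivity
    field_simp
    ring
  rw [hE]
  have : 0 < (12 + 6 * ν + 3 * ν ^ 2) * 2 ^ ν - (12 + ν ^ 2) * 3 ^ ν := by
    have hpos : 0 < (2 * ν ^ 2 - ν ^ 3 / 2) * 2 ^ ν := mul_pos (by nlinarith [sq_pos_of_pos h0]) h2
    nlinarith [mul_le_mul_of_nonneg_left bern (by positivity : 0 ≤ 12 + ν ^ 2)]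
  positivity

theorem stmt6 (ν : ℝ) (hν : ν ∈ Set.Ioo (0:ℝ) 1) (j k : ℕ) (hj : 3 ≤ j) (hk : k ≤ j - 2) :
    0 < dbarco ν j k := by
  have hθ := theta_pos hν
  rw [dbarco, if_neg (by omega)]
  split_ifs with h3 hk2 hk1
  · omega
  · exact dbarco_three_one_pos hν
  · have hd : 0 < dco ν 3 0 :=
      div_pos (neg_pos.2 (Dco_zero_neg hν le_rfl)) (alpha0_pos hν)
    have := dbarco_three_one_pos hν
    positivity
  · obtain ⟨n, rfl⟩ : ∃ n, j = n + 3 := ⟨j - 3, by omega⟩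
    have htop := theta_sq_add_dco_pos hν (j := n + 3) (by omega)
    rw [show n + 3 - 2 = n + 1 by omega] at hk htop ⊢
    rw [Finset.sum_Icc_succ_top hk]
    have hsum : 0 ≤ ∑ i ∈ Finset.Icc k n, dco ν (n + 3) i * theta ν ^ (i - k) :=
      Finset.sum_nonneg fun i hi => by
        have := dco_pos hν (j := n + 3) (k := i) (by omega)
          (by have := (Finset.mem_Icc.1 hi).2; omega)
        positivity
    have hlast := mul_pos htop (pow_pos hθ (n + 1 - k))
    rw [show n + 3 - k = 2 + (n + 1 - k) by omega, pow_add]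
    linarith
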